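/- arXiv:2211.15267 — 2 statements merged into one kernel-verified Lean document; each statement's English description precedes it below -/
import Mathlib

section
/- Let F be a field, m, p ≥ 1, μ = m·μ_0, ν = p·ν_0 for positive integers μ_0, ν_0, and let χ(x) = 1 if x is even and χ(x) = 0 if x is odd. Set R = m(m+1)/2 + ((p−1)(2m^2−m+1) + χ(m)χ(p))/2 and suppose N ≥ R. Assume |F| > (C(N−1, R−1) + C(N−1, R−1−m))·(m^2 p + p − 2) if char F ≠ 2, or |F| > C(N−1, R−1)·(m^2 p + p − 2) if char F = 2. Then there exist N points α_1, ..., α_N ∈ F such that for every subset S ⊆ {1,...,N} with |S| = R and for all matrices A, A' ∈ F^{μ×ν}: if f_A(α_i)·g_A(α_i) = f_{A'}(α_i)·g_{A'}(α_i) for all i ∈ S, then A·Aᵀ = A'·A'ᵀ. In other words, the matrix A·Aᵀ is uniquely determined by the worker outputs f_A(α_i)g_A(α_i) at any R of the N evaluation points. -/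
open Finset Matrix

/-- The `(k,j)` block (of size `μ₀ × ν₀`) of a matrix `A ∈ F^{(m·μ₀) × (p·ν₀)}`:
block `A_{k,j}` occupies rows `k·μ₀, ..., (k+1)·μ₀ - 1` and columns
`j·ν₀, ..., (j+1)·ν₀ - 1`. -/
def matBlock (F : Type*) [Field F] (m p μ₀ ν₀ : ℕ)
    (A : Matrix (Fin (m * μ₀)) (Fin (p * ν₀)) F) (k : Fin m) (j : Fin p) :
    Matrix (Fin μ₀) (Fin ν₀) F :=
  Matrix.of fun u v => A (finProdFinEquiv (k, u)) (finProdFinEquiv (j, v))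

/-- Evaluation of the encoding polynomial `f_A(x) = Σ_{k,j} A_{k,j} x^{kp+j}`. -/
def fAeval (F : Type*) [Field F] (m p μ₀ ν₀ : ℕ)
    (A : Matrix (Fin (m * μ₀)) (Fin (p * ν₀)) F) (x : F) :
    Matrix (Fin μ₀) (Fin ν₀) F :=
  ∑ k : Fin m, ∑ j : Fin p,
    x ^ ((k : ℕ) * p + (j : ℕ)) • matBlock F m p μ₀ ν₀ A k j

/-- Evaluation of the encoding polynomial `g_A(x) = Σ_{s,i} A_{s,i}ᵀ x^{smp+p-1-i}`. -/
def gAeval (F : Type*) [Field F] (m p μ₀ ν₀ : ℕ)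
    (A : Matrix (Fin (m * μ₀)) (Fin (p * ν₀)) F) (x : F) :
    Matrix (Fin ν₀) (Fin μ₀) F :=
  ∑ s : Fin m, ∑ i : Fin p,
    x ^ ((s : ℕ) * (m * p) + (p - 1 - (i : ℕ))) • (matBlock F m p μ₀ ν₀ A s i)ᵀ

/-- `χ(x) = 1` if `x` is even, `0` if `x` is odd. -/
def chi (x : ℕ) : ℕ := if Even x then 1 else 0


open Module in
/-- Intersecting with the kernel of a functional lowers the dimension by at most one. -/
theorem finrank_le_finrank_inf_ker_add_one {F V : Type*} [Field F] [AddCommGroup V] [Module F V]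
    [FiniteDimensional F V] (K : Submodule F V) (f : V →ₗ[F] F) :
    finrank F K ≤ finrank F ↥(K ⊓ LinearMap.ker f) + 1 := by
  have h1 := Submodule.finrank_sup_add_finrank_inf_eq K (LinearMap.ker f)
  have h2 := Submodule.finrank_le (K ⊔ LinearMap.ker f)
  have h3 := f.finrank_range_add_finrank_ker
  have h4 := Submodule.finrank_le (LinearMap.range f)
  rw [finrank_self] at h4
  omega

/-- The elements of `W` killed by the functionals `ev (α s)` for `s ∈ T`. -/
def vanishingOn {F V X : Type*} [Field F] [AddCommGroup V] [Module F V] (ev : X → V →ₗ[F] F)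
    (W : Submodule F V) (α : ℕ → X) (T : Finset ℕ) : Submodule F V :=
  W ⊓ ⨅ s ∈ T, LinearMap.ker (ev (α s))

theorem mem_vanishingOn {F V X : Type*} [Field F] [AddCommGroup V] [Module F V]
    {ev : X → V →ₗ[F] F} {W : Submodule F V} {α : ℕ → X} {T : Finset ℕ} {v : V} :
    v ∈ vanishingOn ev W α T ↔ v ∈ W ∧ ∀ s ∈ T, ev (α s) v = 0 := by
  simp [vanishingOn]

theorem vanishingOn_insert {F V X : Type*} [Field F] [AddCommGroup V] [Module F V]
    (ev : X → V →ₗ[F] F) (W : Submodule F V) (α : ℕ → X) (T : Finset ℕ) (a : ℕ) :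
    vanishingOn ev W α (insert a T) = vanishingOn ev W α T ⊓ LinearMap.ker (ev (α a)) := by
  ext v
  simp only [Submodule.mem_inf, mem_vanishingOn, Finset.forall_mem_insert, LinearMap.mem_ker]
  tauto

theorem choose_min_le_choose {n N r : ℕ} (hn : n < N) (hr : r ≤ N) :
    n.choose (min n (r - 1)) ≤ (N - 1).choose (r - 1) := by
  rcases le_total n (r - 1) with h | h
  · rw [min_eq_left h, Nat.choose_self]
    exact Nat.choose_pos (by omega)
  · rw [min_eq_right h]
    exact Nat.choose_le_choose _ (by omega)

open Module in
/-- Greedy choice of points in general position with respect to finitely many subspaces. -/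
theorem exists_nat_points {F V X ι : Type*} [Field F] [AddCommGroup V] [Module F V]
    [FiniteDimensional F V] [Fintype ι] (ev : X → V →ₗ[F] F) (d : ℕ)
    (hd : ∀ v ≠ 0, ∃ Z : Finset X, #Z ≤ d ∧ ∀ x, ev x v = 0 → x ∈ Z)
    (W : ι → Submodule F V) (r : ι → ℕ) (hW : ∀ i, finrank F (W i) ≤ r i) (N : ℕ)
    (hr : ∀ i, r i ≤ N)
    (hX : (((∑ i, (N - 1).choose (r i - 1)) * d : ℕ) : Cardinal) < Cardinal.mk X) :
    ∀ n ≤ N, ∃ α : ℕ → X, ∀ i, ∀ T ⊆ range n, #T = min n (r i) →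
      finrank F (vanishingOn ev (W i) α T) + #T ≤ r i := by
  classical
  have hXne : Nonempty X := by
    rw [← Cardinal.mk_ne_zero_iff]
    exact (pos_of_gt hX).ne'
  choose! Z hZd hZ using hd
  intro n
  induction n with
  | zero =>
    refine fun _ => ⟨fun _ => hXne.some, fun i T hT hc => ?_⟩
    obtain rfl : T = ∅ := by simpa using hT
    exact (Nat.add_le_add_right (Submodule.finrank_mono inf_le_left) _).trans (by simpa using hW i)
  | succ n ih =>
    intro hn
    obtain ⟨α, hα⟩ := ih (by omega)
    have hv : ∀ i T, ∃ v : V, vanishingOn ev (W i) α T ≠ ⊥ →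
        v ∈ vanishingOn ev (W i) α T ∧ v ≠ 0 := fun i T => by
      by_cases h : vanishingOn ev (W i) α T = ⊥
      · exact ⟨0, fun h' => absurd h h'⟩
      · obtain ⟨v, hv⟩ := Submodule.exists_mem_ne_zero_of_ne_bot h
        exact ⟨v, fun _ => hv⟩
    choose v hv using hv
    let B : Finset X := univ.biUnion fun i =>
      ((range n).powersetCard (min n (r i - 1))).biUnion fun T =>
        if v i T = 0 then ∅ else Z (v i T)
    have hB : #B ≤ (∑ i, (N - 1).choose (r i - 1)) * d := by
      rw [Finset.sum_mul]
      refine card_biUnion_le.trans (Finset.sum_le_sum fun i _ => ?_)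
      refine (card_biUnion_le_card_mul _ _ d fun T _ => ?_).trans (Nat.mul_le_mul_right _ ?_)
      · split_ifs with h
        · simp
        · exact hZd _ h
      · rw [card_powersetCard, card_range]
        exact choose_min_le_choose (by omega) (hr i)
    obtain ⟨x, hx⟩ : ∃ x, x ∉ B := by
      by_contra! h
      have : Cardinal.mk X ≤ #B := by
        rw [← Cardinal.mk_coe_finset]
        exact Cardinal.mk_le_of_injective (f := fun x => (⟨x, h x⟩ : B))
          fun a b hab => congrArg Subtype.val hab
      exact absurd (this.trans (Nat.cast_le.2 hB)) (not_le.2 hX)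
    refine ⟨Function.update α n x, fun i T hT hc => ?_⟩
    have hcongr : ∀ U ⊆ range n, vanishingOn ev (W i) (Function.update α n x) U =
        vanishingOn ev (W i) α U := fun U hU => by
      ext w
      simp only [mem_vanishingOn]
      refine and_congr_right fun _ => forall₂_congr fun s hs => ?_
      rw [Function.update_of_ne (Finset.mem_range.1 (hU hs)).ne]
    by_cases hnT : n ∈ T
    · obtain ⟨U, hnU, rfl⟩ : ∃ U, n ∉ U ∧ insert n U = T :=
        ⟨T.erase n, notMem_erase _ _, insert_erase hnT⟩
      have hU : U ⊆ range n := fun s hs => by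
        have h1 := Finset.mem_range.1 (hT (mem_insert_of_mem hs))
        have h2 : s ≠ n := fun h => hnU (h ▸ hs)
        exact Finset.mem_range.2 (by omega)
      rw [card_insert_of_notMem hnU] at hc ⊢
      have hUr : finrank F (vanishingOn ev (W i) α U) + #U ≤ r i := by
        by_cases h : #U = min n (r i)
        · exact hα i U hU h
        · obtain ⟨a, ha, haU⟩ : ∃ a ∈ range n, a ∉ U := by
            apply exists_mem_notMem_of_card_lt_card
            rw [card_range]; omega
          have h1 := hα i (insert a U) (insert_subset ha hU)
            (by rw [card_insert_of_notMem haU]; omega)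
          have h2 := finrank_le_finrank_inf_ker_add_one (vanishingOn ev (W i) α U) (ev (α a))
          rw [← vanishingOn_insert] at h2
          rw [card_insert_of_notMem haU] at h1
          omega
      rw [vanishingOn_insert, hcongr U hU, Function.update_self]
      by_cases hbot : vanishingOn ev (W i) α U = ⊥
      · rw [hbot, bot_inf_eq, finrank_bot]
        omega
      · obtain ⟨h1, h2⟩ := hv i U hbot
        have h3 : vanishingOn ev (W i) α U ⊓ LinearMap.ker (ev x) < vanishingOn ev (W i) α U := by
          refine lt_of_le_of_ne inf_le_left fun h => hx ?_
          have h4 : ev x (v i U) = 0 := (h.symm ▸ h1 : _ ∈ _ ⊓ LinearMap.ker (ev x)).2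
          refine mem_biUnion.2 ⟨i, mem_univ _, mem_biUnion.2 ⟨U, ?_, ?_⟩⟩
          · exact mem_powersetCard.2 ⟨hU, by omega⟩
          · rw [if_neg h2]
            exact hZ _ h2 _ h4
        have := Submodule.finrank_lt_finrank_of_lt h3
        omega
    · have hT' : T ⊆ range n := fun s hs => by
        have h1 := Finset.mem_range.1 (hT hs)
        have h2 : s ≠ n := fun h => hnT (h ▸ hs)
        exact Finset.mem_range.2 (by omega)
      have h1 := card_le_card hT'
      rw [card_range] at h1
      rw [hcongr T hT']
      exact hα i T hT' (by omega)

open Module in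
theorem exists_points {F V X ι : Type*} [Field F] [AddCommGroup V] [Module F V]
    [FiniteDimensional F V] [Fintype ι] (ev : X → V →ₗ[F] F) (d : ℕ)
    (hd : ∀ v ≠ 0, ∃ Z : Finset X, #Z ≤ d ∧ ∀ x, ev x v = 0 → x ∈ Z)
    (W : ι → Submodule F V) (r : ι → ℕ) (hW : ∀ i, finrank F (W i) ≤ r i) (N : ℕ)
    (hr : ∀ i, r i ≤ N)
    (hX : (((∑ i, (N - 1).choose (r i - 1)) * d : ℕ) : Cardinal) < Cardinal.mk X) :
    ∃ α : Fin N → X, ∀ i, ∀ S : Finset (Fin N), r i ≤ #S →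
      ∀ w ∈ W i, (∀ s ∈ S, ev (α s) w = 0) → w = 0 := by
  obtain ⟨α, hα⟩ := exists_nat_points ev d hd W r hW N hr hX N le_rfl
  refine ⟨fun s => α s, fun i S hS w hw hSw => ?_⟩
  obtain ⟨T, hTS, hT⟩ := exists_subset_card_eq hS
  have h1 := hα i (T.map Fin.valEmbedding)
    (fun s hs => by
      obtain ⟨t, -, rfl⟩ := mem_map.1 hs
      exact Finset.mem_range.2 t.2)
    (by rw [card_map, hT, min_eq_right (hr i)])
  rw [card_map, hT] at h1
  have h2 : vanishingOn ev (W i) α (T.map Fin.valEmbedding) = ⊥ :=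
    Submodule.finrank_eq_zero.1 (by omega)
  rw [← Submodule.mem_bot F, ← h2, mem_vanishingOn]
  refine ⟨hw, fun s hs => ?_⟩
  obtain ⟨t, ht, rfl⟩ := mem_map.1 hs
  exact hSw t (hTS ht)

/-- Evaluation at `x` of the polynomial with coefficients `h`. -/
def evalCoeff {F : Type*} [Field F] (n : ℕ) (x : F) : (Fin n → F) →ₗ[F] F :=
  ∑ e : Fin n, x ^ (e : ℕ) • LinearMap.proj e

theorem evalCoeff_apply {F : Type*} [Field F] (n : ℕ) (x : F) (h : Fin n → F) :
    evalCoeff n x h = ∑ e : Fin n, x ^ (e : ℕ) * h e := by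
  simp [evalCoeff]

open Polynomial in
theorem exists_finset_evalCoeff_eq_zero {F : Type*} [Field F] (d : ℕ) (h : Fin (d + 1) → F)
    (hh : h ≠ 0) :
    ∃ Z : Finset F, #Z ≤ d ∧ ∀ x, evalCoeff (d + 1) x h = 0 → x ∈ Z := by
  classical
  have hP : ((degreeLTEquiv F (d + 1)).symm h : F[X]) ≠ 0 := by simpa using hh
  have hdeg := natDegree_lt_iff_degree_lt hP |>.2
    (mem_degreeLT.1 ((degreeLTEquiv F (d + 1)).symm h).2)
  refine ⟨((degreeLTEquiv F (d + 1)).symm h : F[X]).roots.toFinset,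
    (Multiset.toFinset_card_le _).trans ((card_roots' _).trans (by omega)), fun x hx => ?_⟩
  rw [Multiset.mem_toFinset, mem_roots hP, IsRoot.def, eval_eq_sum_degreeLTEquiv
    ((degreeLTEquiv F (d + 1)).symm h).2, ← hx, evalCoeff_apply]
  simp [mul_comm]


/-- Summation over the fibres of `f`, as a linear map. -/
def fiberSum (F : Type*) {X Y : Type*} [Field F] [Fintype X] [DecidableEq Y] (f : X → Y) :
    (X → F) →ₗ[F] (Y → F) where
  toFun h y := ∑ x with f x = y, h x
  map_add' _ _ := funext fun _ => sum_add_distrib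
  map_smul' _ _ := funext fun _ => (mul_sum ..).symm

theorem fiberSum_apply {F X Y : Type*} [Field F] [Fintype X] [DecidableEq Y] (f : X → Y)
    (h : X → F) (y : Y) : fiberSum F f h y = ∑ x with f x = y, h x := rfl

theorem fiberSum_fiberSum {F X Y Z : Type*} [Field F] [Fintype X] [Fintype Y] [DecidableEq Y]
    [DecidableEq Z] (f : X → Y) (g : Y → Z) (h : X → F) :
    fiberSum F g (fiberSum F f h) = fiberSum F (g ∘ f) h := by
  ext z
  simp only [fiberSum_apply, Function.comp_apply]
  rw [← Finset.sum_fiberwise_of_maps_to (s := univ.filter fun x => g (f x) = z)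
    (t := univ.filter fun y => g y = z) (g := f) (by simp)]
  refine sum_congr rfl fun y hy => ?_
  rw [filter_filter]
  refine sum_congr (filter_congr fun x _ => ?_) fun _ _ => rfl
  simp only [mem_filter, mem_univ, true_and] at hy
  exact ⟨fun h => ⟨h ▸ hy, h⟩, fun h => h.2⟩

theorem fiberSum_comp_equiv {F X Y : Type*} [Field F] [Fintype X] [DecidableEq Y] (f : X → Y)
    (σ : Equiv.Perm X) (τ : Y → Y) (hτ : Function.Involutive τ) (hf : ∀ x, f (σ x) = τ (f x))
    (h : X → F) (y : Y) : fiberSum F f (h ∘ σ) y = fiberSum F f h (τ y) := by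
  simp only [fiberSum_apply]
  refine Finset.sum_equiv σ (fun x => ?_) fun _ _ => rfl
  simp only [mem_filter, mem_univ, true_and, hf]
  exact hτ.injective.eq_iff.symm

theorem fiberSum_surjective {F X Y : Type*} [Field F] [Fintype X] [DecidableEq Y] {f : X → Y}
    (hf : Function.Surjective f) : Function.Surjective (fiberSum F f) := by
  classical
  intro g
  obtain ⟨s, hs⟩ := hf.hasRightInverse
  refine ⟨fun x => if s (f x) = x then g (f x) else 0, funext fun y => ?_⟩
  rw [fiberSum_apply, sum_eq_single (s y)]
  · simp [hs y]
  · intro x hx hne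
    simp only [mem_filter, mem_univ, true_and] at hx
    rw [hx, if_neg (Ne.symm hne)]
  · simp [hs y]

theorem sum_mul_fiberSum {F X Y : Type*} [Field F] [Fintype X] [Fintype Y] [DecidableEq Y]
    (f : X → Y) (h : X → F) (c : Y → F) :
    ∑ y, c y * fiberSum F f h y = ∑ x, c (f x) * h x := by
  rw [← Finset.sum_fiberwise univ f]
  refine sum_congr rfl fun y _ => ?_
  rw [fiberSum_apply, mul_sum]
  refine sum_congr rfl fun x hx => ?_
  rw [(mem_filter.1 hx).2]

/-- The functions `h` on `E` whose fibre sums along `l` satisfy `g x + c x * g (τ x) = 0`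
for all `x ∈ Q`. -/
def foldedSubmodule {F E Λ : Type*} [Field F] [Fintype E] [DecidableEq Λ] (l : E → Λ)
    (τ : Λ → Λ) (Q : Finset Λ) (c : Λ → F) : Submodule F (E → F) where
  carrier := {h | ∀ x ∈ Q, fiberSum F l h x + c x * fiberSum F l h (τ x) = 0}
  zero_mem' := by simp
  add_mem' {a b} ha hb x hx := by
    rw [map_add, Pi.add_apply, Pi.add_apply]
    linear_combination ha x hx + hb x hx
  smul_mem' t a ha x hx := by
    rw [map_smul, Pi.smul_apply, Pi.smul_apply, smul_eq_mul, smul_eq_mul]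
    linear_combination t * ha x hx

theorem mem_foldedSubmodule {F E Λ : Type*} [Field F] [Fintype E] [DecidableEq Λ] {l : E → Λ}
    {τ : Λ → Λ} {Q : Finset Λ} {c : Λ → F} {h : E → F} :
    h ∈ foldedSubmodule l τ Q c ↔
      ∀ x ∈ Q, fiberSum F l h x + c x * fiberSum F l h (τ x) = 0 := Iff.rfl

open Module in
theorem finrank_foldedSubmodule_add_card {F E Λ : Type*} [Field F] [Fintype E] [DecidableEq Λ]
    {l : E → Λ} (hl : Function.Surjective l) {τ : Λ → Λ} {Q : Finset Λ} {c : Λ → F}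
    (hQ : ∀ x ∈ Q, c x = 0 ∨ τ x ∉ Q) :
    finrank F (foldedSubmodule l τ Q c) + #Q = Fintype.card E := by
  let L : (E → F) →ₗ[F] (Q → F) := LinearMap.pi fun x =>
    LinearMap.proj (x : Λ) ∘ₗ fiberSum F l + c x • LinearMap.proj (τ x) ∘ₗ fiberSum F l
  have hL : ∀ h x, L h x = fiberSum F l h x + c x * fiberSum F l h (τ x) := fun _ _ => rfl
  have hker : LinearMap.ker L = foldedSubmodule l τ Q c := by
    ext h
    simp [mem_foldedSubmodule, funext_iff, hL]
  have hsurj : Function.Surjective L := fun y => by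
    obtain ⟨h, hh⟩ := fiberSum_surjective (F := F) hl fun x => if hx : x ∈ Q then y ⟨x, hx⟩ else 0
    refine ⟨h, funext fun x => ?_⟩
    rw [hL, hh]
    dsimp only
    rw [dif_pos x.2]
    rcases hQ x x.2 with h0 | h0 <;> simp [h0]
  have h1 := L.finrank_range_add_finrank_ker
  rw [hker, LinearMap.range_eq_top.2 hsurj, finrank_top, finrank_fintype_fun_eq_card,
    finrank_fintype_fun_eq_card, Fintype.card_coe] at h1
  omega

theorem card_lt_involution {Λ : Type*} [Fintype Λ] [LinearOrder Λ] {τ : Λ → Λ}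
    (hτ : Function.Involutive τ) :
    2 * #{x | x < τ x} + #{x | τ x = x} = Fintype.card Λ := by
  have h1 : #{x | x < τ x} = #{x | τ x < x} := by
    refine card_bij (fun x _ => τ x) ?_ (fun a _ b _ h => hτ.injective h) fun b hb => ⟨τ b, ?_, hτ b⟩
    · simp [hτ _]
    · simpa [hτ _] using hb
  have h2 : (univ : Finset Λ) =
      (univ.filter (fun x => x < τ x) ∪ univ.filter fun x => τ x < x) ∪
      univ.filter fun x => τ x = x := by
    ext x
    simp only [mem_univ, mem_union, mem_filter, true_and, true_iff]
    exact or_assoc.2 ((lt_trichotomy x (τ x)).imp_right fun h => h.symm.imp_right Eq.symm)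
  rw [← card_univ, congrArg card h2, card_union_of_disjoint, card_union_of_disjoint, ← h1,
    two_mul]
  · exact disjoint_filter.2 fun x _ h h' => lt_asymm h h'
  · rw [← filter_or]
    exact disjoint_filter.2 fun x _ h h' => by rcases h with h | h <;> simp [h'] at h

theorem card_le_involution {Λ : Type*} [Fintype Λ] [LinearOrder Λ] (τ : Λ → Λ) :
    #{x | x ≤ τ x} = #{x | x < τ x} + #{x | τ x = x} := by
  rw [← card_union_of_disjoint, ← filter_or]
  · refine congrArg card (filter_congr fun x _ => ?_)
    rw [le_iff_lt_or_eq, eq_comm (a := x)]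
  · exact disjoint_filter.2 fun x _ h h' => by simp [h'] at h

theorem exists_half_of_involutive {Λ : Type*} [Fintype Λ] [DecidableEq Λ] {τ : Λ → Λ}
    (hτ : Function.Involutive τ) :
    ∃ Q Q' : Finset Λ, (∀ x ∈ Q, τ x ∉ Q) ∧ (∀ x ∈ Q', τ x = x ∨ τ x ∉ Q') ∧
      2 * #Q + #{x | τ x = x} = Fintype.card Λ ∧ #Q' = #Q + #{x | τ x = x} := by
  classical
  let := LinearOrder.lift' (Fintype.equivFin Λ) (Fintype.equivFin Λ).injective
  refine ⟨univ.filter fun x => x < τ x, univ.filter fun x => x ≤ τ x, fun x hx => ?_,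
    fun x hx => ?_, ?_, ?_⟩
  · simp only [mem_filter, mem_univ, true_and] at hx
    simpa [hτ x] using hx.le
  · simp only [mem_filter, mem_univ, true_and, hτ x] at hx ⊢
    exact or_iff_not_imp_right.2 fun h => le_antisymm (not_not.1 h) hx
  · convert card_lt_involution hτ
  · convert card_le_involution τ

theorem exists_folded_points {F I Λ : Type*} [Field F] [Fintype I] [Fintype Λ] [DecidableEq Λ]
    {d : ℕ} (e : I → Fin (d + 1)) {l : Fin (d + 1) → Λ} (hl : Function.Surjective l)
    (σ : Equiv.Perm I) {τ : Λ → Λ} (hτ : Function.Involutive τ)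
    (he : ∀ a, l (e (σ a)) = τ (l (e a))) {R R' N : ℕ} (hRN : R ≤ N) (hR' : R' ≤ R)
    (hcard : 2 * (d + 1) + #{x | τ x = x} ≤ 2 * R + Fintype.card Λ)
    (hcard' : 2 * (d + 1) ≤ 2 * R' + Fintype.card Λ + #{x | τ x = x})
    (hF2 : ringChar F = 2 →
      (((N - 1).choose (R - 1) * d : ℕ) : Cardinal) < Cardinal.mk F)
    (hFne : ringChar F ≠ 2 →
      ((((N - 1).choose (R - 1) + (N - 1).choose (R' - 1)) * d : ℕ) : Cardinal) <
        Cardinal.mk F) :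
    ∃ α : Fin N → F, ∀ S : Finset (Fin N), #S = R → ∀ G : I → F,
      (∀ i ∈ S, ∑ a, α i ^ (e a : ℕ) * G a = 0) →
      (∀ i ∈ S, ∑ a, α i ^ (e a : ℕ) * G (σ a) = 0) →
      fiberSum F e G = 0 := by
  obtain ⟨Q, Q', hQ, hQ', hQc, hQc'⟩ := exists_half_of_involutive hτ
  set W : Submodule F (Fin (d + 1) → F) := foldedSubmodule l τ Q fun _ => -1 with hW
  set W' : Submodule F (Fin (d + 1) → F) :=
    foldedSubmodule l τ Q' fun x => if τ x = x then 0 else 1 with hW'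
  have hrank : Module.finrank F W ≤ R := by
    have := finrank_foldedSubmodule_add_card (F := F) hl (τ := τ) (Q := Q) (c := fun _ => -1)
      fun x hx => .inr (hQ x hx)
    rw [Fintype.card_fin, ← hW] at this
    omega
  have hrank' : Module.finrank F W' ≤ R' := by
    have := finrank_foldedSubmodule_add_card (F := F) hl (τ := τ) (Q := Q')
      (c := fun x => if τ x = x then 0 else 1) fun x hx => (hQ' x hx).imp_left fun h => if_pos h
    rw [Fintype.card_fin, ← hW'] at this
    omega
  suffices h : ∃ α : Fin N → F, ∀ S : Finset (Fin N), #S = R →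
      (∀ w ∈ W, (∀ s ∈ S, evalCoeff (d + 1) (α s) w = 0) → w = 0) ∧
      (∀ w : Fin (d + 1) → F, (∀ x, fiberSum F l w (τ x) = -fiberSum F l w x) →
        (∀ x, τ x = x → fiberSum F l w x = 0) →
        (∀ s ∈ S, evalCoeff (d + 1) (α s) w = 0) → w = 0) by
    obtain ⟨α, hα⟩ := h
    refine ⟨α, fun S hS G h1 h2 => ?_⟩
    have hτG : ∀ x, fiberSum F l (fiberSum F e (G ∘ σ)) x =
        fiberSum F l (fiberSum F e G) (τ x) := fun x => by
      rw [fiberSum_fiberSum, fiberSum_fiberSum]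
      exact fiberSum_comp_equiv (l ∘ e) σ τ hτ he G x
    have hev : ∀ (H : I → F) (x : F), evalCoeff (d + 1) x (fiberSum F e H) =
        ∑ a, x ^ (e a : ℕ) * H a := fun H x => by
      rw [evalCoeff_apply, sum_mul_fiberSum e H fun y => x ^ (y : ℕ)]
    obtain ⟨hW, hW'⟩ := hα S hS
    have hsymm : fiberSum F e G - fiberSum F e (G ∘ σ) = 0 := by
      refine hW' _ (fun x => ?_) (fun x hx => ?_) fun s hs => ?_
      · rw [map_sub, Pi.sub_apply, Pi.sub_apply, hτG, hτG, hτ]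
        ring
      · rw [map_sub, Pi.sub_apply, hτG, hx, sub_self]
      · rw [map_sub, hev, hev, h1 s hs]
        simpa using h2 s hs
    refine hW _ (fun x _ => ?_) fun s hs => by rw [hev, h1 s hs]
    rw [← hτG, ← sub_eq_zero.1 hsymm]
    ring
  by_cases h2 : ringChar F = 2
  · have : CharP F 2 := h2 ▸ ringChar.charP F
    obtain ⟨α, hα⟩ := exists_points (ι := Unit) (evalCoeff (F := F) (d + 1)) d
      (exists_finset_evalCoeff_eq_zero d) (fun _ => W) (fun _ => R) (fun _ => hrank) N
      (fun _ => hRN) (by simpa using hF2 h2)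
    refine ⟨α, fun S hS => ⟨hα () S hS.ge, fun w hw _ => hα () S hS.ge w fun x _ => ?_⟩⟩
    rw [hw, neg_one_mul, neg_neg, CharTwo.add_self_eq_zero]
  · obtain ⟨α, hα⟩ := exists_points (ι := Bool) (evalCoeff (F := F) (d + 1)) d
      (exists_finset_evalCoeff_eq_zero d) (fun b => cond b W W') (fun b => cond b R R')
      (Bool.rec hrank' hrank) N (Bool.rec (hR'.trans hRN) hRN) (by simpa using hFne h2)
    refine ⟨α, fun S hS => ⟨hα true S hS.ge, fun w hw hw0 =>
      hα false S (hR'.trans hS.ge) w fun x _ => ?_⟩⟩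
    by_cases hx : τ x = x
    · simp [hx, hw0 x hx]
    · simp [hx, hw x]

/-- The exponent of `x` in front of `A_{k,j} A_{s,i}ᵀ` in `f_A(x) g_A(x)`,
for the index `((k, j), (s, i))`. -/
def prodExponent {m p : ℕ} (a : (Fin m × Fin p) × (Fin m × Fin p)) : ℕ :=
  ((a.1.1 : ℕ) * p + (a.1.2 : ℕ)) + ((a.2.1 : ℕ) * (m * p) + (p - 1 - (a.2.2 : ℕ)))

theorem prodExponent_lt {m p : ℕ} (a : (Fin m × Fin p) × (Fin m × Fin p)) :
    prodExponent a < m ^ 2 * p + p - 2 + 1 := by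
  obtain ⟨⟨⟨k, hk⟩, ⟨j, hj⟩⟩, ⟨⟨s, hs⟩, ⟨i, hi⟩⟩⟩ := a
  simp only [prodExponent]
  obtain ⟨m, rfl⟩ : ∃ n, m = n + 1 := ⟨m - 1, by omega⟩
  have h1 : k * p ≤ m * p := Nat.mul_le_mul_right _ (by omega)
  have h2 : s * ((m + 1) * p) ≤ m * ((m + 1) * p) := Nat.mul_le_mul_right _ (by omega)
  have h3 : (m + 1) ^ 2 * p = m * p + m * ((m + 1) * p) + p := by ring
  omega

/-- The label of an exponent: the exponents `(k + s m) p + p - 1`, which carry the blocks of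
`A Aᵀ`, are labelled by `(k, s)`, the others `t p + r` by `t` modulo `m + 1` and `r`. -/
def exponentLabel (m p : ℕ) [NeZero m] (e : ℕ) : (Fin m × Fin m) ⊕ (ZMod (m + 1) × Fin (p - 1)) :=
  if h : e % p < p - 1 then .inr ((e / p : ℕ), ⟨e % p, h⟩)
  else .inl (Fin.ofNat m (e / p), Fin.ofNat m (e / p / m))

/-- The effect on labels of transposing the product `f_A(x) g_A(x)`. -/
def labelSwap (m p : ℕ) : (Fin m × Fin m) ⊕ (ZMod (m + 1) × Fin (p - 1)) →
    (Fin m × Fin m) ⊕ (ZMod (m + 1) × Fin (p - 1)) :=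
  Sum.map Prod.swap fun x => (1 - x.1, x.2.rev)

theorem labelSwap_involutive (m p : ℕ) : Function.Involutive (labelSwap m p) := by
  rintro (x | ⟨c, r⟩) <;> simp [labelSwap]

theorem exponentLabel_mul_add_of_lt {m p : ℕ} [NeZero m] {t r : ℕ} (hr : r < p - 1) :
    exponentLabel m p (t * p + r) = .inr ((t : ℕ), ⟨r, hr⟩) := by
  have h1 : (t * p + r) % p = r := by
    rw [mul_comm, Nat.mul_add_mod, Nat.mod_eq_of_lt (by omega)]
  have h2 : (t * p + r) / p = t := by
    rw [mul_comm, Nat.mul_add_div (by omega), Nat.div_eq_of_lt (by omega), add_zero]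
  simp [exponentLabel, h1, h2, hr]

theorem exponentLabel_block {m p : ℕ} [NeZero m] (hp : 1 ≤ p) (k s : Fin m) :
    exponentLabel m p ((k + s * m) * p + (p - 1)) = .inl (k, s) := by
  have h1 : (((k : ℕ) + s * m) * p + (p - 1)) % p = p - 1 := by
    rw [mul_comm, Nat.mul_add_mod, Nat.mod_eq_of_lt (by omega)]
  have h2 : (((k : ℕ) + s * m) * p + (p - 1)) / p = k + s * m := by
    rw [mul_comm, Nat.mul_add_div (by omega), Nat.div_eq_of_lt (by omega), add_zero]
  have h3 : ((k : ℕ) + s * m) / m = s := by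
    rw [add_comm, mul_comm, Nat.mul_add_div (by omega), Nat.div_eq_of_lt k.2, add_zero]
  simp only [exponentLabel, h1, h2, h3, lt_irrefl, dite_false]
  congr 2 <;> ext <;> simp [Nat.mod_eq_of_lt]

theorem exponentLabel_prodExponent {m p : ℕ} [NeZero m] (k s : Fin m) (j i : Fin p) :
    exponentLabel m p (prodExponent ((k, j), (s, i))) =
      if h0 : i = j then .inl (k, s)
      else if h : j < i then .inr ((k - s : ZMod (m + 1)), ⟨p - 1 - (i - j), by omega⟩)
      else .inr ((k - s + 1 : ZMod (m + 1)), ⟨j - i - 1, by omega⟩) := by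
  have hm : (m : ZMod (m + 1)) = -1 := by
    rw [eq_neg_iff_add_eq_zero]
    exact_mod_cast ZMod.natCast_self (m + 1)
  have hmul : (k + s * m : ℕ) * p = k * p + s * (m * p) := by ring
  split_ifs with h1 h2
  · subst h1
    rw [← exponentLabel_block (Fin.pos i)]
    simp only [prodExponent]
    congr 1
    rw [hmul]
    omega
  · have : prodExponent ((k, j), (s, i)) = (k + s * m : ℕ) * p + (p - 1 - (i - j)) := by
      simp only [prodExponent]
      rw [hmul]
      omega
    rw [this, exponentLabel_mul_add_of_lt (by omega)]
    congr 2
    push_cast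
    rw [hm]
    ring
  · have : prodExponent ((k, j), (s, i)) = (k + s * m + 1 : ℕ) * p + (j - i - 1) := by
      simp only [prodExponent]
      rw [add_mul, hmul]
      omega
    rw [this, exponentLabel_mul_add_of_lt (by omega)]
    congr 2
    push_cast
    rw [hm]
    ring

theorem exponentLabel_prodExponent_swap {m p : ℕ} [NeZero m]
    (a : (Fin m × Fin p) × (Fin m × Fin p)) :
    exponentLabel m p (prodExponent a.swap) =
      labelSwap m p (exponentLabel m p (prodExponent a)) := by
  obtain ⟨⟨k, j⟩, ⟨s, i⟩⟩ := a
  rw [Prod.swap_prod_mk, exponentLabel_prodExponent, exponentLabel_prodExponent]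
  rcases lt_trichotomy i j with h | rfl | h
  · rw [dif_neg h.ne', dif_pos h, dif_neg h.ne, dif_neg h.not_gt]
    simp only [labelSwap, Sum.map_inr, Sum.inr.injEq, Prod.mk.injEq, Fin.ext_iff, Fin.val_rev]
    refine ⟨by ring, by omega⟩
  · simp [labelSwap]
  · rw [dif_neg h.ne, dif_neg h.not_gt, dif_neg h.ne', dif_pos h]
    simp only [labelSwap, Sum.map_inr, Sum.inr.injEq, Prod.mk.injEq, Fin.ext_iff, Fin.val_rev]
    refine ⟨by ring, by omega⟩

theorem exponentLabel_prodExponent_eq_inl {m p : ℕ} [NeZero m] {k s k' s' : Fin m}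
    {j i : Fin p} :
    exponentLabel m p (prodExponent ((k', j), (s', i))) = .inl (k, s) ↔
      k' = k ∧ s' = s ∧ i = j := by
  rw [exponentLabel_prodExponent]
  split_ifs with h1 h2 <;> simp [h1]

theorem exponentLabel_surjective {m p : ℕ} [NeZero m] (hp : 1 ≤ p) :
    Function.Surjective fun e : Fin (m ^ 2 * p + p - 2 + 1) => exponentLabel m p e := by
  have hm : 1 ≤ m := NeZero.one_le
  rintro (⟨k, s⟩ | ⟨c, r, hr⟩)
  · refine ⟨⟨(k + s * m) * p + (p - 1), ?_⟩, exponentLabel_block hp k s⟩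
    have h1 : ((k : ℕ) + s * m) + 1 ≤ m ^ 2 := by nlinarith [k.2, s.2]
    have h2 := Nat.mul_le_mul_right p h1
    rw [add_mul] at h2
    omega
  · refine ⟨⟨c.val * p + r, ?_⟩, ?_⟩
    · have h1 : c.val ≤ m ^ 2 := (Nat.lt_succ_iff.1 c.val_lt).trans (by nlinarith)
      have h2 := Nat.mul_le_mul_right p h1
      omega
    · simp only [exponentLabel_mul_add_of_lt hr, ZMod.natCast_zmod_val]

theorem card_fixed_labelSwap_inr_le (m p : ℕ) (hm : 1 ≤ m) :
    #{x : ZMod (m + 1) × Fin (p - 1) | (1 - x.1, x.2.rev) = x} ≤ chi m * chi p := by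
  have key : ∀ x : ZMod (m + 1) × Fin (p - 1), (1 - x.1, x.2.rev) = x →
      2 * x.1.val = m + 2 ∧ 2 * (x.2 : ℕ) + 2 = p := by
    rintro ⟨c, r⟩ h
    simp only [Prod.mk.injEq, Fin.ext_iff, Fin.val_rev] at h
    obtain ⟨h1, h2⟩ := h
    dsimp only
    refine ⟨?_, by omega⟩
    have h3 : ((2 * c.val : ℕ) : ZMod (m + 1)) = (1 : ℕ) := by
      push_cast
      rw [ZMod.natCast_zmod_val]
      linear_combination -h1
    rw [ZMod.natCast_eq_natCast_iff, Nat.ModEq, Nat.mod_eq_of_lt (a := 1) (by omega)] at h3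
    have h4 := c.val_lt
    have h5 := Nat.div_add_mod (2 * c.val) (m + 1)
    have h6 : 2 * c.val / (m + 1) < 2 := Nat.div_lt_of_lt_mul (by omega)
    interval_cases h7 : 2 * c.val / (m + 1) <;> omega
  rcases eq_empty_or_nonempty
    (univ.filter fun x : ZMod (m + 1) × Fin (p - 1) => (1 - x.1, x.2.rev) = x) with h | ⟨x, hx⟩
  · rw [h]; simp
  · obtain ⟨h1, h2⟩ := key x (by simpa using hx)
    have hm2 : Even m := ⟨x.1.val - 1, by omega⟩
    have hp2 : Even p := ⟨(x.2 : ℕ) + 1, by omega⟩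
    rw [chi, chi, if_pos hm2, if_pos hp2]
    refine card_le_one.2 fun a ha b hb => ?_
    obtain ⟨h3, h4⟩ := key a (by simpa using ha)
    obtain ⟨h5, h6⟩ := key b (by simpa using hb)
    exact Prod.ext (ZMod.val_injective _ (by omega)) (Fin.ext (by omega))

theorem card_fixed_labelSwap (m p : ℕ) :
    #{x | labelSwap m p x = x} =
      m + #{x : ZMod (m + 1) × Fin (p - 1) | (1 - x.1, x.2.rev) = x} := by
  rw [card_filter, Fintype.sum_sum_type, ← card_filter, ← card_filter]
  simp only [labelSwap, Sum.map_inl, Sum.map_inr, Sum.inl.injEq, Sum.inr.injEq]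
  congr 1
  calc #{x : Fin m × Fin m | x.swap = x} = #(univ.image fun k : Fin m => (k, k)) := by
        congr 1
        ext ⟨a, b⟩
        simp [eq_comm]
    _ = m := by
        rw [card_image_of_injective _ fun a b h => congrArg Prod.fst h, card_univ,
          Fintype.card_fin]

/-- The entry `(u, v)` of the product `A_{k,j} A_{s,i}ᵀ`, for the index `((k, j), (s, i))`. -/
def blockProdEntry (F : Type*) [Field F] (m p μ₀ ν₀ : ℕ)
    (A : Matrix (Fin (m * μ₀)) (Fin (p * ν₀)) F) (u v : Fin μ₀)
    (a : (Fin m × Fin p) × (Fin m × Fin p)) : F :=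
  (matBlock F m p μ₀ ν₀ A a.1.1 a.1.2 * (matBlock F m p μ₀ ν₀ A a.2.1 a.2.2)ᵀ) u v

theorem blockProdEntry_swap (F : Type*) [Field F] (m p μ₀ ν₀ : ℕ)
    (A : Matrix (Fin (m * μ₀)) (Fin (p * ν₀)) F) (u v : Fin μ₀)
    (a : (Fin m × Fin p) × (Fin m × Fin p)) :
    blockProdEntry F m p μ₀ ν₀ A u v a.swap = blockProdEntry F m p μ₀ ν₀ A v u a := by
  simp only [blockProdEntry, Matrix.mul_apply, Matrix.transpose_apply, Prod.fst_swap,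
    Prod.snd_swap]
  exact sum_congr rfl fun _ _ => mul_comm _ _

theorem fAeval_mul_gAeval_apply (F : Type*) [Field F] (m p μ₀ ν₀ : ℕ)
    (A : Matrix (Fin (m * μ₀)) (Fin (p * ν₀)) F) (x : F) (u v : Fin μ₀) :
    (fAeval F m p μ₀ ν₀ A x * gAeval F m p μ₀ ν₀ A x) u v =
      ∑ a, x ^ prodExponent a * blockProdEntry F m p μ₀ ν₀ A u v a := by
  simp only [fAeval, gAeval]
  rw [← Fintype.sum_prod_type' (f := fun (k : Fin m) (j : Fin p) =>
      x ^ ((k : ℕ) * p + (j : ℕ)) • matBlock F m p μ₀ ν₀ A k j),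
    ← Fintype.sum_prod_type' (f := fun (s : Fin m) (i : Fin p) =>
      x ^ ((s : ℕ) * (m * p) + (p - 1 - (i : ℕ))) • (matBlock F m p μ₀ ν₀ A s i)ᵀ),
    Matrix.sum_mul]
  simp only [Matrix.mul_sum]
  rw [← Fintype.sum_prod_type' (f := fun (b c : Fin m × Fin p) =>
      x ^ ((b.1 : ℕ) * p + (b.2 : ℕ)) • matBlock F m p μ₀ ν₀ A b.1 b.2 *
        x ^ ((c.1 : ℕ) * (m * p) + (p - 1 - (c.2 : ℕ))) • (matBlock F m p μ₀ ν₀ A c.1 c.2)ᵀ),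
    Matrix.sum_apply]
  refine sum_congr rfl fun a _ => ?_
  rw [Matrix.smul_mul, Matrix.mul_smul, smul_smul, ← pow_add, Matrix.smul_apply, smul_eq_mul]
  rfl

theorem mul_transpose_apply_finProdFinEquiv (F : Type*) [Field F] (m p μ₀ ν₀ : ℕ)
    (A : Matrix (Fin (m * μ₀)) (Fin (p * ν₀)) F) (k s : Fin m) (u v : Fin μ₀) :
    (A * Aᵀ) (finProdFinEquiv (k, u)) (finProdFinEquiv (s, v)) =
      ∑ j, blockProdEntry F m p μ₀ ν₀ A u v ((k, j), (s, j)) := by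
  rw [Matrix.mul_apply, ← finProdFinEquiv.sum_comp, Fintype.sum_prod_type]
  rfl

theorem sum_exponentLabel_eq_inl {F : Type*} [Field F] {m p : ℕ} [NeZero m] (k s : Fin m)
    (G : (Fin m × Fin p) × (Fin m × Fin p) → F) :
    fiberSum F (fun a => exponentLabel m p (prodExponent a)) G (.inl (k, s)) =
      ∑ j, G ((k, j), (s, j)) := by
  rw [fiberSum_apply]
  symm
  refine sum_bij (fun j _ => ((k, j), (s, j))) (fun j _ => ?_) (fun j _ j' _ h => ?_) ?_
    fun _ _ => rfl
  · simp [exponentLabel_prodExponent_eq_inl]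
  · simpa using h
  · rintro ⟨⟨k', j⟩, ⟨s', i⟩⟩ h
    obtain ⟨rfl, rfl, rfl⟩ := exponentLabel_prodExponent_eq_inl.1 (mem_filter.1 h).2
    exact ⟨_, mem_univ _, rfl⟩

theorem two_mul_recovery_threshold {m p R : ℕ} (hm : 1 ≤ m) (hp : 1 ≤ p)
    (hR : R = m * (m + 1) / 2 + ((p - 1) * (2 * m ^ 2 - m + 1) + chi m * chi p) / 2) :
    2 * R = m * (m + 1) + ((p - 1) * (2 * m ^ 2 - m + 1) + chi m * chi p) := by
  have h1 := Nat.even_mul_succ_self m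
  have h2 : Even ((p - 1) * (2 * m ^ 2 - m + 1) + chi m * chi p) := by
    have h3 : m ≤ 2 * m ^ 2 := by nlinarith
    unfold chi
    split_ifs with hm2 hp2 hp2 <;> simp [Nat.even_add, Nat.even_sub, hm2, hp2, h3, hp, parity_simps]
  rw [hR, mul_add, Nat.two_mul_div_two_of_even h1, Nat.two_mul_div_two_of_even h2]

/-- (Theorem 6, folded polynomial codes for general `m, p`.)
With `R = C(m+1,2) + ((p-1)(2m²-m+1) + χ(m)χ(p))/2`, `N ≥ R`, and the stated
field-size conditions, there exist `N` evaluation points such that the product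
`A·Aᵀ` is uniquely determined by the worker outputs `f_A(αᵢ)·g_A(αᵢ)` at any `R`
of the `N` points. -/
theorem stmt_4 (F : Type*) [Field F] (m p μ₀ ν₀ N R : ℕ)
    (hm : 1 ≤ m) (hp : 1 ≤ p) (hμ : 1 ≤ μ₀) (hν : 1 ≤ ν₀)
    (hR : R = m * (m + 1) / 2 + ((p - 1) * (2 * m ^ 2 - m + 1) + chi m * chi p) / 2)
    (hN : R ≤ N)
    (hF2 : ringChar F = 2 →
      (((N - 1).choose (R - 1) * (m ^ 2 * p + p - 2) : ℕ) : Cardinal) < Cardinal.mk F)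
    (hFne : ringChar F ≠ 2 →
      ((((N - 1).choose (R - 1) + (N - 1).choose (R - 1 - m)) * (m ^ 2 * p + p - 2) : ℕ)
          : Cardinal) < Cardinal.mk F) :
    ∃ α : Fin N → F, ∀ S : Finset (Fin N), S.card = R →
      ∀ A A' : Matrix (Fin (m * μ₀)) (Fin (p * ν₀)) F,
        (∀ i ∈ S,
          fAeval F m p μ₀ ν₀ A (α i) * gAeval F m p μ₀ ν₀ A (α i)
            = fAeval F m p μ₀ ν₀ A' (α i) * gAeval F m p μ₀ ν₀ A' (α i)) →
        A * Aᵀ = A' * A'ᵀ := by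
  have : NeZero m := ⟨by omega⟩
  have hR2 := two_mul_recovery_threshold hm hp hR
  have hmm : 2 * m ≤ m * (m + 1) := by nlinarith
  have hΛ : Fintype.card ((Fin m × Fin m) ⊕ (ZMod (m + 1) × Fin (p - 1))) =
      m * m + (m + 1) * (p - 1) := by
    simp [ZMod.card]
  have hfix := card_fixed_labelSwap m p
  have hfix' := card_fixed_labelSwap_inr_le m p hm
  have hcard : 2 * (m ^ 2 * p + p - 2 + 1) + m + chi m * chi p =
      2 * R + (m * m + (m + 1) * (p - 1)) := by
    obtain ⟨q, rfl⟩ : ∃ q, p = q + 1 := ⟨p - 1, by omega⟩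
    obtain ⟨w, hw⟩ : ∃ w, 2 * m ^ 2 = m + w :=
      ⟨2 * m ^ 2 - m, (Nat.add_sub_of_le (by nlinarith)).symm⟩
    rw [hR2, hw, Nat.add_sub_cancel_left, Nat.add_sub_cancel]
    have h1 : m ^ 2 * (q + 1) + (q + 1) - 2 + 1 = m ^ 2 * (q + 1) + q := by
      have : 1 ≤ m ^ 2 * (q + 1) := Nat.mul_pos (by positivity) (by omega)
      omega
    rw [h1]
    linear_combination q * hw
  obtain ⟨α, hα⟩ := exists_folded_points (F := F) (I := (Fin m × Fin p) × (Fin m × Fin p))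
    (fun a => ⟨prodExponent a, prodExponent_lt a⟩) (exponentLabel_surjective hp)
    (Equiv.prodComm _ _) (labelSwap_involutive m p) exponentLabel_prodExponent_swap
    (R := R) (R' := R - m) hN (Nat.sub_le _ _) (by omega) (by omega) hF2
    (by rwa [Nat.sub_right_comm])
  refine ⟨α, fun S hS A A' h => ?_⟩
  have hsum : ∀ (i) (_ : i ∈ S) (u v : Fin μ₀), ∑ a, α i ^ prodExponent a *
      (blockProdEntry F m p μ₀ ν₀ A u v a - blockProdEntry F m p μ₀ ν₀ A' u v a) = 0 := by
    intro i hi u v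
    have h1 := congrFun (congrFun (h i hi) u) v
    rw [fAeval_mul_gAeval_apply, fAeval_mul_gAeval_apply] at h1
    simp only [mul_sub, sum_sub_distrib, h1, sub_self]
  ext a b
  obtain ⟨⟨k, u⟩, rfl⟩ := finProdFinEquiv.surjective a
  obtain ⟨⟨s, v⟩, rfl⟩ := finProdFinEquiv.surjective b
  have h0 := hα S hS
    (fun a => blockProdEntry F m p μ₀ ν₀ A u v a - blockProdEntry F m p μ₀ ν₀ A' u v a)
    (fun i hi => hsum i hi u v) fun i hi => by
      simpa only [Equiv.coe_prodComm, blockProdEntry_swap] using hsum i hi v u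
  have h1 := sum_exponentLabel_eq_inl k s fun a =>
    blockProdEntry F m p μ₀ ν₀ A u v a - blockProdEntry F m p μ₀ ν₀ A' u v a
  have h2 := congrFun (fiberSum_fiberSum (F := F)
    (fun a : (Fin m × Fin p) × (Fin m × Fin p) =>
      (⟨prodExponent a, prodExponent_lt a⟩ : Fin (m ^ 2 * p + p - 2 + 1)))
    (fun e => exponentLabel m p e) fun a =>
    blockProdEntry F m p μ₀ ν₀ A u v a - blockProdEntry F m p μ₀ ν₀ A' u v a) (.inl (k, s))
  rw [h0, map_zero] at h2
  rw [mul_transpose_apply_finProdFinEquiv, mul_transpose_apply_finProdFinEquiv, ← sub_eq_zero,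
    ← sum_sub_distrib, ← h1]
  exact h2.symm
end

section
/- Let F be a field, m, p ≥ 1, and let A ∈ F^{μ×ν} (μ = m·μ_0, ν = p·ν_0) with blocks A_{k,j}, f_A(x) = Σ_{k,j} A_{k,j} x^{kp+j}, g_A(x) = Σ_{s,i} A_{s,i}ᵀ x^{smp+p−1−i}, C_{k,s} = Σ_{i=0}^{p−1} A_{k,i}A_{s,i}ᵀ and B_{k,s,t} = Σ_{i=0}^{p−1−t} A_{k,i+t}A_{s,i}ᵀ. Then for all row/column indices u, v ∈ {0,...,μ_0−1}, the scalar polynomial identity holds: [f_A(x)g_A(x)]_{u,v} − [f_A(x)g_A(x)]_{v,u} = Σ_{0 ≤ s < k ≤ m−1} ([C_{k,s}]_{u,v} − [C_{k,s}]_{v,u}) (x^{smp+kp+p−1} − x^{kmp+sp+p−1}) + Σ_{k=0}^{m−1} Σ_{s=0}^{m−1} Σ_{t=1}^{p−1} ([B_{k,s,t}]_{u,v} − [B_{k,s,t}]_{v,u}) (x^{smp+kp+p−1+t} − x^{kmp+sp+p−1−t}), where [M]_{u,v} denotes the (u,v)-entry of the matrix M and [f_A(x)g_A(x)]_{u,v}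 denotes the polynomial obtained by taking the (u,v)-entry of each matrix coefficient of f_A(x)g_A(x). -/
open Finset Matrix Polynomial

/-- The matrix-coefficient polynomial `f_A(x) = Σ_{k,j} A_{k,j} x^{kp+j}`. -/
noncomputable def fApoly (F : Type*) [Field F] (m p μ₀ ν₀ : ℕ)
    (A : Matrix (Fin (m * μ₀)) (Fin (p * ν₀)) F) :
    Matrix (Fin μ₀) (Fin ν₀) (Polynomial F) :=
  ∑ k : Fin m, ∑ j : Fin p,
    (X : Polynomial F) ^ ((k : ℕ) * p + (j : ℕ)) • (matBlock F m p μ₀ ν₀ A k j).map C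

/-- The matrix-coefficient polynomial `g_A(x) = Σ_{s,i} A_{s,i}ᵀ x^{smp+p-1-i}`. -/
noncomputable def gApoly (F : Type*) [Field F] (m p μ₀ ν₀ : ℕ)
    (A : Matrix (Fin (m * μ₀)) (Fin (p * ν₀)) F) :
    Matrix (Fin ν₀) (Fin μ₀) (Polynomial F) :=
  ∑ s : Fin m, ∑ i : Fin p,
    (X : Polynomial F) ^ ((s : ℕ) * (m * p) + (p - 1 - (i : ℕ))) •
      ((matBlock F m p μ₀ ν₀ A s i).map C)ᵀ

/-- `B_{k,s,t} = Σ_{i=0}^{p-1-t} A_{k,i+t} · A_{s,i}ᵀ`. -/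
def Bmat (F : Type*) [Field F] (m p μ₀ ν₀ : ℕ)
    (A : Matrix (Fin (m * μ₀)) (Fin (p * ν₀)) F) (k s : Fin m) (t : ℕ) :
    Matrix (Fin μ₀) (Fin μ₀) F :=
  ∑ i : Fin p, ∑ j : Fin p,
    if (j : ℕ) = (i : ℕ) + t then
      matBlock F m p μ₀ ν₀ A k j * (matBlock F m p μ₀ ν₀ A s i)ᵀ
    else 0

/-- `C_{k,s} = Σ_{i=0}^{p-1} A_{k,i} · A_{s,i}ᵀ`. -/
def Cmat (F : Type*) [Field F] (m p μ₀ ν₀ : ℕ)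
    (A : Matrix (Fin (m * μ₀)) (Fin (p * ν₀)) F) (k s : Fin m) :
    Matrix (Fin μ₀) (Fin μ₀) F :=
  ∑ i : Fin p, matBlock F m p μ₀ ν₀ A k i * (matBlock F m p μ₀ ν₀ A s i)ᵀ

/-- Two pairs of summation variables may be interchanged. -/
theorem sum_sum_sum_sum_comm {ι κ M : Type*} [Fintype ι] [Fintype κ] [AddCommMonoid M]
    (f : ι → ι → κ → κ → M) :
    ∑ j, ∑ i, ∑ k, ∑ s, f j i k s = ∑ k, ∑ s, ∑ j, ∑ i, f j i k s := by
  calc _ = ∑ x : ι × ι, ∑ y : κ × κ, f x.1 x.2 y.1 y.2 := by simp only [Fintype.sum_prod_type]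
    _ = ∑ y : κ × κ, ∑ x : ι × ι, f x.1 x.2 y.1 y.2 := Finset.sum_comm
    _ = _ := by simp only [Fintype.sum_prod_type]

/-- A double sum over a linear order splits into off-diagonal pairs and the diagonal. -/
theorem sum_sum_eq_sum_lt_add_swap_add_diag {ι M : Type*} [Fintype ι] [LinearOrder ι]
    [AddCommMonoid M] (f : ι → ι → M) :
    ∑ k, ∑ s, f k s
      = (∑ k, ∑ s, if s < k then f k s + f s k else 0) + ∑ k, f k k := by
  have h1 : ∀ k s, f k s
      = ((if s < k then f k s else 0) + if k < s then f k s else 0)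
        + if k = s then f k s else 0 := by
    intro k s
    rcases lt_trichotomy s k with h | h | h
    · simp [h, h.not_gt, h.ne']
    · simp [h]
    · simp [h, h.not_gt, h.ne]
  have h2 : ∀ k s, (if s < k then f k s + f s k else 0)
      = (if s < k then f k s else 0) + if s < k then f s k else 0 := by
    intro k s
    split_ifs <;> simp
  have h3 : ∑ k, ∑ s, (if k < s then f k s else 0) = ∑ k, ∑ s, if s < k then f s k else 0 :=
    Finset.sum_comm
  calc ∑ k, ∑ s, f k s
      = ∑ k, ∑ s, (((if s < k then f k s else 0) + if k < s then f k s else 0)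
          + if k = s then f k s else 0) :=
        Finset.sum_congr rfl fun k _ => Finset.sum_congr rfl fun s _ => h1 k s
    _ = _ := by
        simp only [h2, Finset.sum_add_distrib, h3]
        simp

/-- Summing over the difference `t = j - i` of two indices `i < j` below `p`. -/
theorem sum_Icc_sum_sum_ite_eq_add {M : Type*} [AddCommMonoid M] (p : ℕ)
    (f : Fin p → Fin p → ℕ → M) :
    (∑ t ∈ Finset.Icc 1 (p - 1), ∑ i : Fin p, ∑ j : Fin p,
        if (j : ℕ) = (i : ℕ) + t then f j i t else 0)
      = ∑ j : Fin p, ∑ i : Fin p, if i < j then f j i ((j : ℕ) - (i : ℕ)) else 0 := by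
  rw [Finset.sum_comm, Finset.sum_comm (γ := Fin p) (α := Fin p)]
  refine Finset.sum_congr rfl fun i _ => ?_
  rw [Finset.sum_comm]
  refine Finset.sum_congr rfl fun j _ => ?_
  split_ifs with h
  · have hij : (i : ℕ) < j := h
    rw [Finset.sum_eq_single ((j : ℕ) - (i : ℕ))]
    · rw [if_pos (by omega)]
    · intro t _ ht
      rw [if_neg (by omega)]
    · intro ht
      exact absurd (Finset.mem_Icc.2 ⟨by omega, by omega⟩) ht
  · have hij : ¬ (i : ℕ) < j := h
    refine Finset.sum_eq_zero fun t ht => ?_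
    rw [Finset.mem_Icc] at ht
    rw [if_neg (by omega)]

/-- The difference of the `(u,v)` and `(v,u)` entries of `A_{k,j} A_{s,i}ᵀ`. -/
def blockSkew (F : Type*) [Field F] (m p μ₀ ν₀ : ℕ)
    (A : Matrix (Fin (m * μ₀)) (Fin (p * ν₀)) F) (u v : Fin μ₀)
    (k : Fin m) (j : Fin p) (s : Fin m) (i : Fin p) : F :=
  (matBlock F m p μ₀ ν₀ A k j * (matBlock F m p μ₀ ν₀ A s i)ᵀ) u v
    - (matBlock F m p μ₀ ν₀ A k j * (matBlock F m p μ₀ ν₀ A s i)ᵀ) v u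

section blockSkew

variable (F : Type*) [Field F] (m p μ₀ ν₀ : ℕ)
  (A : Matrix (Fin (m * μ₀)) (Fin (p * ν₀)) F) (u v : Fin μ₀)

theorem blockSkew_swap (k : Fin m) (j : Fin p) (s : Fin m) (i : Fin p) :
    blockSkew F m p μ₀ ν₀ A u v s i k j = -blockSkew F m p μ₀ ν₀ A u v k j s i := by
  have h : ∀ a b, (matBlock F m p μ₀ ν₀ A s i * (matBlock F m p μ₀ ν₀ A k j)ᵀ) a b
      = (matBlock F m p μ₀ ν₀ A k j * (matBlock F m p μ₀ ν₀ A s i)ᵀ) b a := by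
    intro a b
    simp only [Matrix.mul_apply, Matrix.transpose_apply, mul_comm]
  simp only [blockSkew, h, neg_sub]

theorem blockSkew_self (k : Fin m) (j : Fin p) :
    blockSkew F m p μ₀ ν₀ A u v k j k j = 0 := by
  have h : (matBlock F m p μ₀ ν₀ A k j * (matBlock F m p μ₀ ν₀ A k j)ᵀ) u v
      = (matBlock F m p μ₀ ν₀ A k j * (matBlock F m p μ₀ ν₀ A k j)ᵀ) v u := by
    simp only [Matrix.mul_apply, Matrix.transpose_apply, mul_comm]
  rw [blockSkew, h, sub_self]

theorem Cmat_sub_swap (k s : Fin m) :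
    Cmat F m p μ₀ ν₀ A k s u v - Cmat F m p μ₀ ν₀ A k s v u
      = ∑ i : Fin p, blockSkew F m p μ₀ ν₀ A u v k i s i := by
  simp only [Cmat, blockSkew, Matrix.sum_apply, Finset.sum_sub_distrib]

theorem Bmat_sub_swap (k s : Fin m) (t : ℕ) :
    Bmat F m p μ₀ ν₀ A k s t u v - Bmat F m p μ₀ ν₀ A k s t v u
      = ∑ i : Fin p, ∑ j : Fin p,
          if (j : ℕ) = (i : ℕ) + t then blockSkew F m p μ₀ ν₀ A u v k j s i else 0 := by
  simp only [Bmat, Matrix.sum_apply, ← Finset.sum_sub_distrib]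
  refine Finset.sum_congr rfl fun i _ => Finset.sum_congr rfl fun j _ => ?_
  split_ifs <;> simp [blockSkew]

theorem fApoly_mul_gApoly_apply :
    (fApoly F m p μ₀ ν₀ A * gApoly F m p μ₀ ν₀ A) u v
      = ∑ j : Fin p, ∑ i : Fin p, ∑ k : Fin m, ∑ s : Fin m,
          C ((matBlock F m p μ₀ ν₀ A k j * (matBlock F m p μ₀ ν₀ A s i)ᵀ) u v) *
            (X : Polynomial F) ^ ((k : ℕ) * p + (j : ℕ)
              + ((s : ℕ) * (m * p) + (p - 1 - (i : ℕ)))) := by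
  have h : fApoly F m p μ₀ ν₀ A * gApoly F m p μ₀ ν₀ A
      = ∑ k : Fin m, ∑ j : Fin p, ∑ s : Fin m, ∑ i : Fin p,
          (X : Polynomial F) ^ ((k : ℕ) * p + (j : ℕ)
              + ((s : ℕ) * (m * p) + (p - 1 - (i : ℕ)))) •
            (matBlock F m p μ₀ ν₀ A k j * (matBlock F m p μ₀ ν₀ A s i)ᵀ).map C := by
    simp only [fApoly, Matrix.sum_mul]
    simp only [gApoly, Matrix.mul_sum, Matrix.smul_mul, Matrix.mul_smul, smul_smul, ← pow_add,
      Matrix.map_mul, Matrix.transpose_map, add_comm]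
  rw [h]
  simp only [Matrix.sum_apply, Matrix.smul_apply, Matrix.map_apply, smul_eq_mul]
  rw [Finset.sum_comm]
  refine Finset.sum_congr rfl fun j _ => ?_
  rw [Finset.sum_comm (s := (Finset.univ : Finset (Fin p)))]
  refine Finset.sum_congr rfl fun k _ => ?_
  rw [Finset.sum_comm]
  exact Finset.sum_congr rfl fun i _ => Finset.sum_congr rfl fun s _ => mul_comm _ _

end blockSkew

/-- (Entrywise antisymmetrized identity, eq. (10) of the paper.)
For all entry indices `u, v`, the scalar polynomial
`[f_A g_A]_{u,v} - [f_A g_A]_{v,u}` equals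
`Σ_{s<k} ([C_{k,s}]_{u,v} - [C_{k,s}]_{v,u})(x^{smp+kp+p-1} - x^{kmp+sp+p-1})
 + Σ_{k,s} Σ_{t=1}^{p-1} ([B_{k,s,t}]_{u,v} - [B_{k,s,t}]_{v,u})
     (x^{smp+kp+p-1+t} - x^{kmp+sp+p-1-t})`. -/
theorem stmt_8 (F : Type*) [Field F] (m p μ₀ ν₀ : ℕ)
    (hm : 1 ≤ m) (hp : 1 ≤ p) (hμ : 1 ≤ μ₀) (hν : 1 ≤ ν₀)
    (A : Matrix (Fin (m * μ₀)) (Fin (p * ν₀)) F) :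
    ∀ u v : Fin μ₀,
      (fApoly F m p μ₀ ν₀ A * gApoly F m p μ₀ ν₀ A) u v
        - (fApoly F m p μ₀ ν₀ A * gApoly F m p μ₀ ν₀ A) v u
      = (∑ k : Fin m, ∑ s : Fin m,
          if (s : ℕ) < (k : ℕ) then
            C (Cmat F m p μ₀ ν₀ A k s u v - Cmat F m p μ₀ ν₀ A k s v u) *
              ((X : Polynomial F) ^ ((s : ℕ) * (m * p) + (k : ℕ) * p + (p - 1))
                - (X : Polynomial F) ^ ((k : ℕ) * (m * p) + (s : ℕ) * p + (p - 1)))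
          else 0)
        + ∑ k : Fin m, ∑ s : Fin m, ∑ t ∈ Finset.Icc 1 (p - 1),
            C (Bmat F m p μ₀ ν₀ A k s t u v - Bmat F m p μ₀ ν₀ A k s t v u) *
              ((X : Polynomial F) ^ ((s : ℕ) * (m * p) + (k : ℕ) * p + (p - 1) + t)
                - (X : Polynomial F) ^ ((k : ℕ) * (m * p) + (s : ℕ) * p + (p - 1 - t))) := by
  intro u v
  set W := blockSkew F m p μ₀ ν₀ A u v with hW
  have hL : (fApoly F m p μ₀ ν₀ A * gApoly F m p μ₀ ν₀ A) u v
        - (fApoly F m p μ₀ ν₀ A * gApoly F m p μ₀ ν₀ A) v u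
      = ∑ j : Fin p, ∑ i : Fin p, ∑ k : Fin m, ∑ s : Fin m,
          C (W k j s i) * (X : Polynomial F) ^ ((k : ℕ) * p + (j : ℕ)
              + ((s : ℕ) * (m * p) + (p - 1 - (i : ℕ)))) := by
    simp only [fApoly_mul_gApoly_apply, ← Finset.sum_sub_distrib, ← sub_mul, ← C_sub, hW, blockSkew]
  rw [hL, sum_sum_eq_sum_lt_add_swap_add_diag, add_comm]
  congr 1
  · calc _ = ∑ i : Fin p, ∑ k : Fin m, ∑ s : Fin m, if (s : ℕ) < (k : ℕ) then
            C (W k i s i) *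
              ((X : Polynomial F) ^ ((s : ℕ) * (m * p) + (k : ℕ) * p + (p - 1))
                - (X : Polynomial F) ^ ((k : ℕ) * (m * p) + (s : ℕ) * p + (p - 1))) else 0 := by
          refine Finset.sum_congr rfl fun i _ => ?_
          rw [sum_sum_eq_sum_lt_add_swap_add_diag]
          simp only [hW, blockSkew_self, C_0, zero_mul, Finset.sum_const_zero, add_zero]
          refine Finset.sum_congr rfl fun k _ => Finset.sum_congr rfl fun s _ => ?_
          refine if_congr Fin.lt_def ?_ rfl
          rw [blockSkew_swap F m p μ₀ ν₀ A u v k i s i, C_neg, neg_mul, ← sub_eq_add_neg, ← mul_sub]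
          congr 3 <;> omega
      _ = _ := by
          rw [Finset.sum_comm]
          refine Finset.sum_congr rfl fun k _ => ?_
          rw [Finset.sum_comm]
          refine Finset.sum_congr rfl fun s _ => ?_
          split_ifs
          · rw [Cmat_sub_swap, map_sum, Finset.sum_mul]
          · simp
  · calc _ = ∑ j : Fin p, ∑ i : Fin p, ∑ k : Fin m, ∑ s : Fin m, if i < j then
            C (W k j s i) *
              ((X : Polynomial F) ^ ((s : ℕ) * (m * p) + (k : ℕ) * p + (p - 1)
                  + ((j : ℕ) - (i : ℕ)))
                - (X : Polynomial F) ^ ((k : ℕ) * (m * p) + (s : ℕ) * p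
                  + (p - 1 - ((j : ℕ) - (i : ℕ))))) else 0 := by
          refine Finset.sum_congr rfl fun j _ => Finset.sum_congr rfl fun i _ => ?_
          split_ifs with h
          · have hij : (i : ℕ) < j := h
            rw [Finset.sum_comm (f := fun k s : Fin m => C (W k i s j) * _),
              ← Finset.sum_add_distrib]
            refine Finset.sum_congr rfl fun k _ => ?_
            rw [← Finset.sum_add_distrib]
            refine Finset.sum_congr rfl fun s _ => ?_
            rw [hW, blockSkew_swap F m p μ₀ ν₀ A u v k j s i, C_neg, neg_mul, ← sub_eq_add_neg,
              ← mul_sub]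
            congr 3 <;> omega
          · simp
      _ = ∑ k : Fin m, ∑ s : Fin m, ∑ j : Fin p, ∑ i : Fin p, if i < j then
            C (W k j s i) *
              ((X : Polynomial F) ^ ((s : ℕ) * (m * p) + (k : ℕ) * p + (p - 1)
                  + ((j : ℕ) - (i : ℕ)))
                - (X : Polynomial F) ^ ((k : ℕ) * (m * p) + (s : ℕ) * p
                  + (p - 1 - ((j : ℕ) - (i : ℕ))))) else 0 :=
          sum_sum_sum_sum_comm _
      _ = _ := by
          refine Finset.sum_congr rfl fun k _ => Finset.sum_congr rfl fun s _ => ?_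
          rw [← sum_Icc_sum_sum_ite_eq_add p fun j i t => C (W k j s i) *
              ((X : Polynomial F) ^ ((s : ℕ) * (m * p) + (k : ℕ) * p + (p - 1) + t)
                - (X : Polynomial F) ^ ((k : ℕ) * (m * p) + (s : ℕ) * p + (p - 1 - t)))]
          refine Finset.sum_congr rfl fun t _ => ?_
          simp only [Bmat_sub_swap, map_sum, Finset.sum_mul]
          refine Finset.sum_congr rfl fun i _ => Finset.sum_congr rfl fun j _ => ?_
          split_ifs <;> simp [hW]
end
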